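/- Let ρ, σ : ℝ³ × ℝ → ℝ and F : ℝ³ × ℝ → ℝ³ be C¹, fix t ∈ (0,T), and let φ ∈ C¹(ℝ³; ℝ³) be such that there is a compact set K ⊂ U with φ(x̂(X,t)) = 0 for all X ∈ U \ K. For ε ∈ (−1,1) set E_W[v + εφ](t) = ∫_{Γ(t)} { (div_Γ(v + εφ)) σ + ρ F · (v + εφ) } dH². Then (d/dε)|_{ε=0} E_W[v + εφ](t) = ∫_{Γ(t)} { div_Γ(−σ P_Γ) + ρ F } · φ dH², where div_Γ(−σP_Γ) denotes the row-wise surface divergence of the matrix field −σP_Γ. -/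

import Mathlib

noncomputable section
open MeasureTheory

/-- ℝ² with the Euclidean structure. -/
abbrev E2 : Type := EuclideanSpace ℝ (Fin 2)
/-- ℝ³ with the Euclidean structure. -/
abbrev E3 : Type := EuclideanSpace ℝ (Fin 3)

/-- The cross product on ℝ³. -/
def cross3 (a b : E3) : E3 :=
  (EuclideanSpace.equiv (Fin 3) ℝ).symm
    ![a 1 * b 2 - a 2 * b 1, a 2 * b 0 - a 0 * b 2, a 0 * b 1 - a 1 * b 0]

/-- The dot product on ℝ³. -/
def dot3 (a b : E3) : ℝ := ∑ i, a i * b i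

/-- The tangent vector `g_α = ∂x̂/∂X_α` of the parametrization `x̂` at `(X, t)`. -/
def gVec (xh : E2 × ℝ → E3) (α : Fin 2) (X : E2) (t : ℝ) : E3 :=
  fderiv ℝ (fun Y : E2 => xh (Y, t)) X (EuclideanSpace.single α 1)

/-- The Riemannian metric `g_{αβ} = g_α · g_β`. -/
def gMet (xh : E2 × ℝ → E3) (α β : Fin 2) (X : E2) (t : ℝ) : ℝ :=
  dot3 (gVec xh α X t) (gVec xh β X t)

/-- The Gram determinant `G = g₁₁ g₂₂ − g₁₂ g₂₁`. -/
def Gdet (xh : E2 × ℝ → E3) (X : E2) (t : ℝ) : ℝ :=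
  gMet xh 0 0 X t * gMet xh 1 1 X t - gMet xh 0 1 X t * gMet xh 1 0 X t

/-- The inverse metric `(g^{αβ}) = (g_{αβ})⁻¹`. -/
def gInv (xh : E2 × ℝ → E3) (X : E2) (t : ℝ) : Matrix (Fin 2) (Fin 2) ℝ :=
  (Matrix.of fun α β => gMet xh α β X t)⁻¹

/-- The raised tangent vector `g^α = Σ_β g^{αβ} g_β`. -/
def gVecUp (xh : E2 × ℝ → E3) (α : Fin 2) (X : E2) (t : ℝ) : E3 :=
  ∑ β, gInv xh X t α β • gVec xh β X t

/-- The unit normal `n̂ = (g₁ × g₂)/|g₁ × g₂|` of the parametrized surface. -/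
def nHat (xh : E2 × ℝ → E3) (X : E2) (t : ℝ) : E3 :=
  ‖cross3 (gVec xh 0 X t) (gVec xh 1 X t)‖⁻¹ • cross3 (gVec xh 0 X t) (gVec xh 1 X t)

/-- Spatial partial derivative `∂f/∂x_j` at `(x, t)`. -/
def pdx (j : Fin 3) (f : E3 × ℝ → ℝ) (x : E3) (t : ℝ) : ℝ :=
  fderiv ℝ (fun y : E3 => f (y, t)) x (EuclideanSpace.single j 1)

/-- Time partial derivative `∂f/∂t` at `(x, t)`. -/
def pdt (f : E3 × ℝ → ℝ) (x : E3) (t : ℝ) : ℝ := deriv (fun s => f (x, s)) t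

/-- Tangential derivative `∂_j^Γ f = Σ_i (δ_{ij} − N_i N_j) ∂f/∂x_i`
with normal extension `N`. -/
def tder (N : E3 × ℝ → E3) (j : Fin 3) (f : E3 × ℝ → ℝ) (x : E3) (t : ℝ) : ℝ :=
  ∑ i, ((if i = j then (1 : ℝ) else 0) - N (x, t) i * N (x, t) j) * pdx i f x t

/-- Surface gradient `grad_Γ f = (∂_1^Γ f, ∂_2^Γ f, ∂_3^Γ f)`. -/
def sgrad (N : E3 × ℝ → E3) (f : E3 × ℝ → ℝ) (x : E3) (t : ℝ) : E3 :=
  (EuclideanSpace.equiv (Fin 3) ℝ).symm fun j => tder N j f x t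

/-- Surface divergence `div_Γ φ = Σ_j ∂_j^Γ φ_j`. -/
def sdiv (N : E3 × ℝ → E3) (φ : E3 × ℝ → E3) (x : E3) (t : ℝ) : ℝ :=
  ∑ j, tder N j (fun p => φ p j) x t

/-- Row-wise surface divergence of a matrix field: `(div_Γ M)_i = Σ_j ∂_j^Γ M_{ij}`. -/
def sdivM (N : E3 × ℝ → E3) (M : E3 × ℝ → Matrix (Fin 3) (Fin 3) ℝ) (x : E3) (t : ℝ) : E3 :=
  (EuclideanSpace.equiv (Fin 3) ℝ).symm fun i => ∑ j, tder N j (fun p => M p i j) x t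

/-- The orthogonal projection matrix `P_Γ = I − N ⊗ N`. -/
def Pmat (N : E3 × ℝ → E3) (x : E3) (t : ℝ) : Matrix (Fin 3) (Fin 3) ℝ :=
  Matrix.of fun i j => (if i = j then (1 : ℝ) else 0) - N (x, t) i * N (x, t) j

/-- The symmetric gradient `D(φ) = ((∇φ) + (∇φ)ᵀ)/2`. -/
def Dmat (φ : E3 × ℝ → E3) (x : E3) (t : ℝ) : Matrix (Fin 3) (Fin 3) ℝ :=
  Matrix.of fun i j => (pdx i (fun p => φ p j) x t + pdx j (fun p => φ p i) x t) / 2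

/-- The surface stretching tensor `D_Γ(φ) = P_Γ D(φ) P_Γ`. -/
def DGam (N : E3 × ℝ → E3) (φ : E3 × ℝ → E3) (x : E3) (t : ℝ) : Matrix (Fin 3) (Fin 3) ℝ :=
  Pmat N x t * Dmat φ x t * Pmat N x t

/-- The squared Frobenius norm `|M|² = Σ_{i,j} M_{ij}²`. -/
def frob2 (M : Matrix (Fin 3) (Fin 3) ℝ) : ℝ := ∑ i, ∑ j, (M i j) ^ 2

/-- The material derivative `D_t f = ∂_t f + (v · ∇)f`. -/
def Dt (v : E3 × ℝ → E3) (f : E3 × ℝ → ℝ) (x : E3) (t : ℝ) : ℝ :=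
  pdt f x t + ∑ i, v (x, t) i * pdx i f x t

/-- Matrix-vector product on ℝ³. -/
def mulVec3 (M : Matrix (Fin 3) (Fin 3) ℝ) (w : E3) : E3 :=
  (EuclideanSpace.equiv (Fin 3) ℝ).symm (M.mulVec fun i => w i)

open scoped NNReal ENNReal Topology

section HausdorffArea

/-- A set mapped with smaller distances has smaller Hausdorff measure. -/
lemma hausdorffMeasure_image_le_of_edist_le {α X Y : Type*} [EMetricSpace X] [EMetricSpace Y]
    [MeasurableSpace X] [BorelSpace X] [MeasurableSpace Y] [BorelSpace Y]
    {f : α → X} {g : α → Y} {s : Set α} {L : ℝ≥0}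
    (h : ∀ y ∈ s, ∀ z ∈ s, edist (f y) (f z) ≤ L * edist (g y) (g z)) {d : ℝ} (hd : 0 ≤ d) :
    μH[d] (f '' s) ≤ (L : ℝ≥0∞) ^ d * μH[d] (g '' s) := by
  rcases s.eq_empty_or_nonempty with rfl | ⟨y₀, hy₀⟩
  · simp
  have : Nonempty α := ⟨y₀⟩
  have hmem : ∀ y ∈ s, Function.invFunOn g s (g y) ∈ s := fun y hy =>
    Function.invFunOn_mem ⟨y, hy, rfl⟩
  have hval : ∀ y ∈ s, g (Function.invFunOn g s (g y)) = g y := fun y hy =>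
    Function.invFunOn_eq (f := g) ⟨y, hy, rfl⟩
  have himg : f '' s = (f ∘ Function.invFunOn g s) '' (g '' s) := by
    rw [Set.image_image]
    refine Set.image_congr fun y hy => ?_
    have := h y hy _ (hmem y hy)
    rw [hval y hy, edist_self, mul_zero, nonpos_iff_eq_zero, edist_eq_zero] at this
    exact this
  rw [himg]
  refine LipschitzOnWith.hausdorffMeasure_image_le ?_ hd
  rintro _ ⟨y, hy, rfl⟩ _ ⟨z, hz, rfl⟩
  have := h _ (hmem y hy) _ (hmem z hz)
  rwa [hval y hy, hval z hz] at this

lemma hausdorffMeasure_image_le_of_norm_sub_le {α E F : Type*} [NormedAddCommGroup E]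
    [NormedAddCommGroup F] [MeasurableSpace E] [BorelSpace E] [MeasurableSpace F] [BorelSpace F]
    {f : α → E} {g : α → F} {s : Set α} {L : ℝ≥0}
    (h : ∀ y ∈ s, ∀ z ∈ s, ‖f y - f z‖ ≤ L * ‖g y - g z‖) {d : ℝ} (hd : 0 ≤ d) :
    μH[d] (f '' s) ≤ (L : ℝ≥0∞) ^ d * μH[d] (g '' s) := by
  refine hausdorffMeasure_image_le_of_edist_le (fun y hy z hz => ?_) hd
  rw [edist_nndist, edist_nndist, ← ENNReal.coe_mul, ENNReal.coe_le_coe, ← NNReal.coe_le_coe]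
  simpa [dist_eq_norm] using h y hy z hz

instance isAddHaarMeasure_hausdorffMeasure_two : (μH[2] : Measure E2).IsAddHaarMeasure := by
  have := isAddHaarMeasure_hausdorffMeasure (E := E2)
  simpa using this

lemma apply_eq_smul_add_smul (A : E2 →L[ℝ] E3) (y : E2) :
    A y = y 0 • A (EuclideanSpace.single 0 1) + y 1 • A (EuclideanSpace.single 1 1) := by
  have hy : y = y 0 • EuclideanSpace.single (0 : Fin 2) (1 : ℝ)
      + y 1 • EuclideanSpace.single (1 : Fin 2) (1 : ℝ) := by
    ext i; fin_cases i <;> simp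
  conv_lhs => rw [hy]
  simp

lemma norm_cross3_sq (a b : E3) :
    ‖cross3 a b‖ ^ 2 = ‖a‖ ^ 2 * ‖b‖ ^ 2 - dot3 a b ^ 2 := by
  simp only [EuclideanSpace.norm_sq_eq, cross3, dot3, Fin.sum_univ_three, Real.norm_eq_abs, sq_abs]
  simp
  ring

/-- Cholesky factorization: a linear map into ℝ³ has the same norms as an endomorphism of ℝ²
whose determinant is the area factor. -/
lemma exists_endomorphism_norm_eq (A : E2 →L[ℝ] E3)
    (hA : 0 < ‖cross3 (A (EuclideanSpace.single 0 1)) (A (EuclideanSpace.single 1 1))‖) :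
    ∃ B : E2 →L[ℝ] E2, (∀ y, ‖B y‖ = ‖A y‖) ∧
      LinearMap.det (B : E2 →ₗ[ℝ] E2) =
        ‖cross3 (A (EuclideanSpace.single 0 1)) (A (EuclideanSpace.single 1 1))‖ := by
  set a := A (EuclideanSpace.single 0 1) with ha
  set b := A (EuclideanSpace.single 1 1) with hb
  set J := ‖cross3 a b‖ with hJ
  have hJsq : J ^ 2 = ‖a‖ ^ 2 * ‖b‖ ^ 2 - dot3 a b ^ 2 := norm_cross3_sq a b
  have ha0 : ‖a‖ ≠ 0 := by
    intro h
    rw [h] at hJsq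
    nlinarith [sq_nonneg (dot3 a b), pow_pos hA 2]
  let M : Matrix (Fin 2) (Fin 2) ℝ := !![‖a‖, dot3 a b / ‖a‖; 0, J / ‖a‖]
  refine ⟨LinearMap.toContinuousLinearMap (Matrix.toEuclideanLin M), fun y => ?_, ?_⟩
  · rw [← sq_eq_sq₀ (norm_nonneg _) (norm_nonneg _), apply_eq_smul_add_smul A y, ← ha, ← hb]
    have h1 : ‖y 0 • a + y 1 • b‖ ^ 2
        = y 0 ^ 2 * ‖a‖ ^ 2 + 2 * y 0 * y 1 * dot3 a b + y 1 ^ 2 * ‖b‖ ^ 2 := by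
      simp only [EuclideanSpace.norm_sq_eq, dot3, Fin.sum_univ_three, Real.norm_eq_abs, sq_abs]
      simp
      ring
    rw [h1]
    rw [EuclideanSpace.norm_sq_eq]
    simp [M, Matrix.toLpLin_apply, dotProduct, Fin.sum_univ_two]
    field_simp
    linear_combination (y 1) ^ 2 * hJsq
  · have : LinearMap.det (Matrix.toEuclideanLin M) = M.det := by
      rw [Matrix.toEuclideanLin_eq_toLin_orthonormal, LinearMap.det_toLin]
    rw [LinearMap.coe_toContinuousLinearMap, this, Matrix.det_fin_two]
    simp [M]
    field_simp

/-- The pull-back of the two-dimensional Hausdorff measure has the area factor as its density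
with respect to balls. -/
lemma tendsto_hausdorffMeasure_image_closedBall_div {f : E2 → E3} {A : E2 →L[ℝ] E3} {X : E2}
    (hf : HasStrictFDerivAt f A X)
    (hA : 0 < ‖cross3 (A (EuclideanSpace.single 0 1)) (A (EuclideanSpace.single 1 1))‖) :
    Filter.Tendsto (fun r => μH[2] (f '' Metric.closedBall X r) / μH[2] (Metric.closedBall X r))
      (𝓝[>] 0) (𝓝 (ENNReal.ofReal
        ‖cross3 (A (EuclideanSpace.single 0 1)) (A (EuclideanSpace.single 1 1))‖)) := by
  obtain ⟨B, hBA, hdet⟩ := exists_endomorphism_norm_eq A hA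
  set J := ‖cross3 (A (EuclideanSpace.single 0 1)) (A (EuclideanSpace.single 1 1))‖
  obtain ⟨K, hK, hBK⟩ : ∃ K : ℝ, 0 < K ∧ ∀ y, ‖y‖ ≤ K * ‖B y‖ := by
    have hker : LinearMap.ker (B : E2 →ₗ[ℝ] E2) = ⊥ :=
      LinearMap.ker_eq_bot_of_injective
        ((LinearMap.equivOfDetNeZero _ (by rw [hdet]; exact hA.ne')).injective)
    obtain ⟨K, hK, hanti⟩ := LinearMap.exists_antilipschitzWith (B : E2 →ₗ[ℝ] E2) hker
    refine ⟨K, by exact_mod_cast hK, fun y => ?_⟩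
    simpa using hanti.le_mul_dist y 0
  have key : ∀ L : ℝ≥0, 1 < L → ∀ᶠ r in 𝓝[>] (0 : ℝ),
      μH[2] (f '' Metric.closedBall X r) / μH[2] (Metric.closedBall X r)
        ≤ (L : ℝ≥0∞) ^ (2 : ℝ) * ENNReal.ofReal J ∧
      ENNReal.ofReal J ≤ (L : ℝ≥0∞) ^ (2 : ℝ) *
        (μH[2] (f '' Metric.closedBall X r) / μH[2] (Metric.closedBall X r)) := by
    intro L hL
    have hL' : (1 : ℝ) < L := by exact_mod_cast hL
    have hL0 : (0 : ℝ) < L := by linarith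
    set δ : ℝ := 1 - (L : ℝ)⁻¹ with hδ
    have hδ0 : 0 < δ := by rw [hδ, sub_pos]; exact inv_lt_one_of_one_lt₀ hL'
    have hδL : 1 + δ ≤ L := by
      rw [hδ]
      have : (L : ℝ) * (L : ℝ)⁻¹ = 1 := mul_inv_cancel₀ hL0.ne'
      nlinarith [sq_nonneg ((L : ℝ) - 1), inv_pos.2 hL0]
    have hδL' : L * (1 - δ) = 1 := by
      rw [hδ, sub_sub_cancel]; exact mul_inv_cancel₀ hL0.ne'
    have hc := hf.isLittleO.def (div_pos hδ0 hK)
    obtain ⟨R, hR, hball⟩ := Metric.eventually_nhds_iff_ball.1 hc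
    filter_upwards [Ioo_mem_nhdsGT hR] with r hr
    have hest : ∀ y ∈ Metric.closedBall X r, ∀ z ∈ Metric.closedBall X r,
        |‖f y - f z‖ - ‖B y - B z‖| ≤ δ * ‖B y - B z‖ := by
      intro y hy z hz
      have h1 := hball (y, z) (by
        rw [Metric.mem_ball, Prod.dist_eq]
        exact max_lt ((Metric.mem_closedBall.1 hy).trans_lt hr.2)
          ((Metric.mem_closedBall.1 hz).trans_lt hr.2))
      simp only at h1
      have h2 := abs_norm_sub_norm_le (f y - f z) (A (y - z))
      rw [← hBA] at h2
      rw [← map_sub]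
      calc _ ≤ _ := h2
        _ ≤ _ := h1
        _ ≤ δ / K * (K * ‖B (y - z)‖) := by gcongr; exact hBK _
        _ = _ := by field_simp
    have hle : μH[2] (f '' Metric.closedBall X r)
        ≤ (L : ℝ≥0∞) ^ (2 : ℝ) * μH[2] (B '' Metric.closedBall X r) := by
      refine hausdorffMeasure_image_le_of_norm_sub_le (fun y hy z hz => ?_) (by norm_num)
      have := (abs_le.1 (hest y hy z hz)).2
      nlinarith [norm_nonneg (B y - B z)]
    have hge : μH[2] (B '' Metric.closedBall X r)
        ≤ (L : ℝ≥0∞) ^ (2 : ℝ) * μH[2] (f '' Metric.closedBall X r) := by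
      refine hausdorffMeasure_image_le_of_norm_sub_le (fun y hy z hz => ?_) (by norm_num)
      have h1 := (abs_le.1 (hest y hy z hz)).1
      have h2 : (1 - δ) * ‖B y - B z‖ ≤ ‖f y - f z‖ := by linarith
      have h3 := mul_le_mul_of_nonneg_left h2 hL0.le
      rwa [← mul_assoc, hδL', one_mul] at h3
    rw [Measure.addHaar_image_continuousLinearMap, hdet, abs_of_pos hA] at hle hge
    have hm0 : μH[2] (Metric.closedBall X r) ≠ 0 :=
      (Metric.measure_closedBall_pos _ _ hr.1).ne'
    have hmt : μH[2] (Metric.closedBall X r) ≠ ∞ := measure_closedBall_lt_top.ne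
    constructor
    · rw [ENNReal.div_le_iff hm0 hmt, mul_assoc]
      exact hle
    · rw [← mul_div_assoc, ENNReal.le_div_iff_mul_le (Or.inl hm0) (Or.inl hmt)]
      exact hge
  have hcont : Filter.Tendsto (fun L : ℝ≥0 => (L : ℝ≥0∞) ^ (2 : ℝ)) (𝓝[>] 1) (𝓝 1) := by
    have : Continuous fun L : ℝ≥0 => (L : ℝ≥0∞) ^ (2 : ℝ) :=
      ENNReal.continuous_rpow_const.comp ENNReal.continuous_coe
    simpa using (this.tendsto 1).mono_left nhdsWithin_le_nhds
  have hJ0 : ENNReal.ofReal J ≠ 0 := by simpa using hA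
  refine tendsto_order.2 ⟨fun a ha => ?_, fun a ha => ?_⟩
  · have h1 : Filter.Tendsto (fun L : ℝ≥0 => (L : ℝ≥0∞) ^ (2 : ℝ) * a) (𝓝[>] 1) (𝓝 (1 * a)) :=
      ENNReal.Tendsto.mul_const hcont (Or.inl one_ne_zero)
    rw [one_mul] at h1
    obtain ⟨L, hLa, hL⟩ := ((h1.eventually (gt_mem_nhds ha)).and self_mem_nhdsWithin).exists
    filter_upwards [key L hL] with r hr
    by_contra! hcon
    exact absurd (hr.2.trans (mul_le_mul_right hcon _)) (not_le.2 hLa)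
  · have h1 : Filter.Tendsto (fun L : ℝ≥0 => (L : ℝ≥0∞) ^ (2 : ℝ) * ENNReal.ofReal J) (𝓝[>] 1)
        (𝓝 (1 * ENNReal.ofReal J)) :=
      ENNReal.Tendsto.mul_const hcont (Or.inl one_ne_zero)
    rw [one_mul] at h1
    obtain ⟨L, hLa, hL⟩ := ((h1.eventually (gt_mem_nhds ha)).and self_mem_nhdsWithin).exists
    filter_upwards [key L hL] with r hr
    exact hr.1.trans_lt hLa

/-- The area element of a parametrization of a surface in ℝ³. -/
def areaElt (f : E2 → E3) (X : E2) : ℝ :=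
  ‖cross3 (fderiv ℝ f X (EuclideanSpace.single 0 1)) (fderiv ℝ f X (EuclideanSpace.single 1 1))‖

lemma continuous_cross3 : Continuous fun p : E3 × E3 => cross3 p.1 p.2 := by
  unfold cross3
  refine (EuclideanSpace.equiv (Fin 3) ℝ).symm.continuous.comp (continuous_pi fun i => ?_)
  fin_cases i <;> simp <;> fun_prop

lemma continuous_areaElt {f : E2 → E3} (hf : ContDiff ℝ 1 f) : Continuous (areaElt f) := by
  have h : Continuous (fderiv ℝ f) := hf.continuous_fderiv one_ne_zero
  exact (continuous_cross3.comp
    ((h.clm_apply continuous_const).prodMk (h.clm_apply continuous_const))).norm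

lemma exists_hausdorffMeasure_image_le {f : E2 → E3} (hf : ContDiff ℝ 1 f) {U : Set E2}
    (hU : Bornology.IsBounded U) :
    ∃ L : ℝ≥0, ∀ s ⊆ closure U, μH[2] (f '' s) ≤ (L : ℝ≥0∞) ^ (2 : ℝ) * μH[2] s := by
  obtain ⟨L, hL⟩ := hf.locallyLipschitz.locallyLipschitzOn.exists_lipschitzOnWith_of_compact
    hU.isCompact_closure
  exact ⟨L, fun s hs => (hL.mono hs).hausdorffMeasure_image_le (by norm_num)⟩

lemma hausdorffMeasure_image_closure_lt_top {f : E2 → E3} (hf : ContDiff ℝ 1 f) {U : Set E2}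
    (hU : Bornology.IsBounded U) : μH[2] (f '' closure U) < ∞ := by
  obtain ⟨L, hL⟩ := exists_hausdorffMeasure_image_le hf hU
  exact (hL _ le_rfl).trans_lt (ENNReal.mul_lt_top (by simp) hU.isCompact_closure.measure_lt_top)

/-- **Area formula** for an injectively parametrized surface in ℝ³. -/
theorem setIntegral_image_hausdorffMeasure {f : E2 → E3} (hf : ContDiff ℝ 1 f) {U : Set E2}
    (hUo : IsOpen U) (hUb : Bornology.IsBounded U) (hinj : Set.InjOn f U)
    (hJ : ∀ X ∈ U, 0 < areaElt f X) (g : E3 → ℝ) :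
    ∫ x in f '' U, g x ∂(μH[2] : Measure E3) = ∫ X in U, areaElt f X * g (f X) ∂μH[2] := by
  have hUm : MeasurableSet U := hUo.measurableSet
  have : PolishSpace U := hUo.polishSpace
  let F : U → E3 := fun X => f X
  have hF : MeasurableEmbedding F :=
    (hf.continuous.comp continuous_subtype_val).measurableEmbedding hinj.injective
  have hval : MeasurableEmbedding (Subtype.val : U → E2) := MeasurableEmbedding.subtype_coe hUm
  let ν : Measure E2 := (Measure.comap F μH[2]).map Subtype.val
  have hν : ∀ s, ν s = μH[2] (f '' (s ∩ U)) := by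
    intro s
    rw [hval.map_apply, hF.comap_apply]
    congr 1
    ext x
    simp [F]
    constructor
    · rintro ⟨a, h1, h2, h3⟩; exact ⟨a, ⟨h1, h2⟩, h3⟩
    · rintro ⟨a, ⟨h1, h2⟩, h3⟩; exact ⟨a, h1, h2, h3⟩
  obtain ⟨L, hL⟩ := exists_hausdorffMeasure_image_le hf hUb
  have hνfin : IsFiniteMeasure ν := ⟨by
    rw [hν, Set.univ_inter]
    exact (measure_mono (Set.image_mono subset_closure)).trans_lt
      (hausdorffMeasure_image_closure_lt_top hf hUb)⟩
  have hac : ν ≪ (μH[2] : Measure E2) := by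
    intro s hs
    rw [hν]
    have := hL (s ∩ U) (Set.inter_subset_right.trans subset_closure)
    rw [measure_mono_null Set.inter_subset_left hs, mul_zero] at this
    exact nonpos_iff_eq_zero.1 this
  have hdens : ∀ᵐ X ∂(μH[2] : Measure E2).restrict U,
      ν.rnDeriv μH[2] X = ENNReal.ofReal (areaElt f X) := by
    filter_upwards [ae_restrict_of_ae (Besicovitch.ae_tendsto_rnDeriv ν μH[2]),
      ae_restrict_mem hUm] with X hX hXU
    refine tendsto_nhds_unique hX ?_
    have h := tendsto_hausdorffMeasure_image_closedBall_div
      (hf.contDiffAt.hasStrictFDerivAt (x := X) one_ne_zero) (hJ X hXU)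
    refine h.congr' ?_
    obtain ⟨R, hR, hball⟩ := Metric.isOpen_iff.1 hUo X hXU
    filter_upwards [Ioo_mem_nhdsGT hR] with r hr
    rw [hν, Set.inter_eq_left.2 ((Metric.closedBall_subset_ball hr.2).trans hball)]
  have hνU : ν = ((μH[2] : Measure E2).restrict U).withDensity
      fun X => ENNReal.ofReal (areaElt f X) := by
    rw [← withDensity_congr_ae hdens, ← restrict_withDensity hUm,
      Measure.withDensity_rnDeriv_eq _ _ hac]
    refine (Measure.restrict_eq_self_of_ae_mem ?_).symm
    rw [ae_iff, hν]
    have : {a | a ∉ U} ∩ U = ∅ := by ext; simp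
    rw [this]; simp
  calc ∫ x in f '' U, g x ∂(μH[2] : Measure E3)
      = ∫ x, g x ∂(Measure.comap F μH[2]).map F := by
        rw [hF.map_comap]
        congr 2
        ext x; simp [F]
    _ = ∫ X, g (F X) ∂Measure.comap F μH[2] := hF.integral_map _
    _ = ∫ X, g (f X) ∂ν := (hval.integral_map fun X => g (f X)).symm
    _ = _ := by
        rw [hνU, integral_withDensity_eq_integral_toReal_smul
          (continuous_areaElt hf).measurable.ennreal_ofReal (by simp)]
        simp only [areaElt, ENNReal.toReal_ofReal (norm_nonneg _), smul_eq_mul]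

end HausdorffArea

section SurfaceDivergence

/-- A `C¹` function on an open set vanishing off a compact subset has integrable partial
derivatives of vanishing integral. -/
lemma setIntegral_fderiv_apply_eq_zero {w : E2 → ℝ} (hw : ContDiff ℝ 1 w) {U K : Set E2}
    (hU : IsOpen U) (hK : IsCompact K) (hKU : K ⊆ U) (hwK : ∀ X ∈ U \ K, w X = 0) (e : E2) :
    IntegrableOn (fun X => fderiv ℝ w X e) U μH[2] ∧
      ∫ X in U, fderiv ℝ w X e ∂μH[2] = 0 := by
  let W : E2 → ℝ := U.indicator w
  have hWU : ∀ X ∈ U, W =ᶠ[𝓝 X] w := fun X hX => by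
    filter_upwards [hU.mem_nhds hX] with Y hY
    exact Set.indicator_of_mem hY w
  have hW0 : ∀ X ∉ K, W X = 0 := fun X hX => by
    by_cases hXU : X ∈ U
    · exact (Set.indicator_of_mem hXU w).trans (hwK X ⟨hXU, hX⟩)
    · exact Set.indicator_of_notMem hXU w
  have hWK : ∀ X ∉ K, W =ᶠ[𝓝 X] fun _ => 0 := fun X hX => by
    filter_upwards [hK.isClosed.isOpen_compl.mem_nhds hX] with Y hY
    exact hW0 Y hY
  have hW : ContDiff ℝ 1 W := contDiff_iff_contDiffAt.2 fun X => by
    by_cases hX : X ∈ K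
    · exact hw.contDiffAt.congr_of_eventuallyEq (hWU X (hKU hX))
    · exact contDiffAt_const.congr_of_eventuallyEq (hWK X hX)
  have hWc : HasCompactSupport W := HasCompactSupport.intro hK fun X hX => hW0 X hX
  have hdc : Continuous fun X => fderiv ℝ W X e :=
    (hW.continuous_fderiv one_ne_zero).clm_apply continuous_const
  have hdi : Integrable (fun X => fderiv ℝ W X e) μH[2] :=
    hdc.integrable_of_hasCompactSupport (hWc.fderiv_apply ℝ e)
  have hcongr : Set.EqOn (fun X => fderiv ℝ W X e) (fun X => fderiv ℝ w X e) U :=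
    fun X hX => by simp only [(hWU X hX).fderiv_eq]
  refine ⟨hdi.integrableOn.congr_fun hcongr hU.measurableSet, ?_⟩
  rw [← setIntegral_congr_fun hU.measurableSet hcongr,
    setIntegral_eq_integral_of_forall_compl_eq_zero]
  · have := integral_mul_fderiv_eq_neg_fderiv_mul_of_integrable (μ := (μH[2] : Measure E2))
      (f := fun _ : E2 => (1 : ℝ)) (g := W) (v := e) (by simp) (by simpa using hdi)
      (by simpa using hW.continuous.integrable_of_hasCompactSupport hWc) (by simp)
      (fun X _ => hW.differentiable one_ne_zero X)
    simpa using this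
  · intro X hX
    rw [(hWK X fun h => hX (hKU h)).fderiv_eq]
    simp

lemma contDiff_apply_of_contDiff {E : Type*} [NormedAddCommGroup E] [NormedSpace ℝ E]
    {n : WithTop ℕ∞} {g : E → E3} (hg : ContDiff ℝ n g) (i : Fin 3) :
    ContDiff ℝ n fun p => g p i :=
  contDiff_euclidean.1 hg i

lemma contDiff_slice {E F : Type*} [NormedAddCommGroup E] [NormedSpace ℝ E]
    [NormedAddCommGroup F] [NormedSpace ℝ F] {n : WithTop ℕ∞} {h : E × ℝ → F}
    (hh : ContDiff ℝ n h) (t : ℝ) : ContDiff ℝ n fun y => h (y, t) :=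
  hh.comp (contDiff_id.prodMk contDiff_const)

lemma fderiv_comp_slice {h : E3 × ℝ → ℝ} (hh : ContDiff ℝ 1 h) {f : E2 → E3} {X : E2}
    (hf : DifferentiableAt ℝ f X) (t : ℝ) (e : E2) :
    fderiv ℝ (fun Y => h (f Y, t)) X e = ∑ i, fderiv ℝ f X e i * pdx i h (f X) t := by
  have h1 : DifferentiableAt ℝ (fun y => h (y, t)) (f X) :=
    (contDiff_slice hh t).differentiable one_ne_zero _
  have h2 : fderiv ℝ (fun Y => h (f Y, t)) X = (fderiv ℝ (fun y => h (y, t)) (f X)).comp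
      (fderiv ℝ f X) := fderiv_comp X h1 hf
  have h3 : ∀ u : E3, u = ∑ i, u i • EuclideanSpace.single i (1 : ℝ) := fun u => by
    ext j; fin_cases j <;> simp [Fin.sum_univ_three]
  rw [h2, ContinuousLinearMap.comp_apply]
  conv_lhs => rw [h3 (fderiv ℝ f X e)]
  simp [pdx]

lemma continuous_tder {N : E3 × ℝ → E3} (hN : Continuous N) {h : E3 × ℝ → ℝ}
    (hh : ContDiff ℝ 1 h) (j : Fin 3) (t : ℝ) : Continuous fun x => tder N j h x t := by
  have hp : ∀ i, Continuous fun x => pdx i h x t := fun i =>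
    ((contDiff_slice hh t).continuous_fderiv one_ne_zero).clm_apply continuous_const
  unfold tder
  fun_prop

lemma continuous_sdiv {N φ : E3 × ℝ → E3} (hN : Continuous N) (hφ : ContDiff ℝ 1 φ) (t : ℝ) :
    Continuous fun x => sdiv N φ x t :=
  continuous_finsetSum _ fun j _ => continuous_tder hN (contDiff_apply_of_contDiff hφ j) j t

lemma sdiv_add_const_smul {N φ ψ : E3 × ℝ → E3} (hφ : ContDiff ℝ 1 φ) (hψ : ContDiff ℝ 1 ψ)
    (ε : ℝ) (x : E3) (t : ℝ) :
    sdiv N (fun p => φ p + ε • ψ p) x t = sdiv N φ x t + ε * sdiv N ψ x t := by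
  have hd : ∀ {χ : E3 × ℝ → E3}, ContDiff ℝ 1 χ → ∀ j,
      DifferentiableAt ℝ (fun y => χ (y, t) j) x := fun hχ j =>
    (contDiff_slice (contDiff_apply_of_contDiff hχ j) t).differentiable one_ne_zero _
  have hp : ∀ i j, pdx i (fun p => (φ p + ε • ψ p) j) x t
      = pdx i (fun p => φ p j) x t + ε * pdx i (fun p => ψ p j) x t := fun i j => by
    have h := ((hd hφ j).hasFDerivAt.fun_add ((hd hψ j).hasFDerivAt.const_mul ε)).fderiv
    unfold pdx
    have h' := congrArg (fun l => l (EuclideanSpace.single i (1 : ℝ))) h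
    simpa using h'
  simp only [sdiv, tder, hp, Fin.sum_univ_three]
  ring

lemma contDiff_neg_smul_Pmat_apply {N : E3 × ℝ → E3} (hN : ContDiff ℝ 1 N) {σ : E3 × ℝ → ℝ}
    (hσ : ContDiff ℝ 1 σ) (i j : Fin 3) :
    ContDiff ℝ 1 fun p : E3 × ℝ => ((-σ p) • Pmat N p.1 p.2) i j := by
  have := contDiff_apply_of_contDiff hN
  simp only [Pmat, Matrix.smul_apply, Matrix.of_apply, smul_eq_mul]
  exact hσ.neg.mul (contDiff_const.sub ((this i).mul (this j)))

lemma continuous_sdivM_apply {N : E3 × ℝ → E3} (hN : ContDiff ℝ 1 N) {σ : E3 × ℝ → ℝ}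
    (hσ : ContDiff ℝ 1 σ) (i : Fin 3) (t : ℝ) :
    Continuous fun x => sdivM N (fun p => (-σ p) • Pmat N p.1 p.2) x t i := by
  change Continuous fun x => ∑ j, tder N j (fun p => ((-σ p) • Pmat N p.1 p.2) i j) x t
  exact continuous_finsetSum _ fun j _ =>
    continuous_tder hN.continuous (contDiff_neg_smul_Pmat_apply hN hσ i j) j t

/-- The tangential derivatives in terms of the parameter derivatives: the rescaled dual basis of
`p, q` is `q × n, n × p`. -/
lemma areaElt_mul_tder {N : E3 × ℝ → E3} {x : E3} {t J : ℝ} {p q n : E3} (hn : N (x, t) = n)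
    (hJ : J • n = cross3 p q) (hnn : dot3 n n = 1) (h : E3 × ℝ → ℝ) (j : Fin 3) :
    J * tder N j h x t = (∑ i, p i * pdx i h x t) * cross3 q n j
      + (∑ i, q i * pdx i h x t) * cross3 n p j := by
  have h0 := congrArg (fun u : E3 => u 0) hJ
  have h1 := congrArg (fun u : E3 => u 1) hJ
  have h2 := congrArg (fun u : E3 => u 2) hJ
  simp [cross3] at h0 h1 h2
  simp only [dot3, Fin.sum_univ_three] at hnn
  simp only [tder, hn, Fin.sum_univ_three]
  set H₀ := pdx 0 h x t
  set H₁ := pdx 1 h x t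
  set H₂ := pdx 2 h x t
  fin_cases j <;> simp [cross3]
  · linear_combination (-(J * H₀)) * hnn + H₀ * (n 0 * h0 + n 1 * h1 + n 2 * h2)
      - (n 0 * H₀ + n 1 * H₁ + n 2 * H₂) * h0
  · linear_combination (-(J * H₁)) * hnn + H₁ * (n 0 * h0 + n 1 * h1 + n 2 * h2)
      - (n 0 * H₀ + n 1 * H₁ + n 2 * H₂) * h1
  · linear_combination (-(J * H₂)) * hnn + H₂ * (n 0 * h0 + n 1 * h1 + n 2 * h2)
      - (n 0 * H₀ + n 1 * H₁ + n 2 * H₂) * h2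

/-- The cross product of two vectors orthogonal to a unit vector is parallel to it. -/
lemma cross3_apply_eq_of_orthogonal {n q a : E3} (hnn : dot3 n n = 1) (hq : dot3 n q = 0)
    (ha : dot3 n a = 0) (i : Fin 3) : cross3 q a i = n i * dot3 n (cross3 q a) := by
  simp only [dot3, Fin.sum_univ_three] at *
  fin_cases i <;> simp [cross3]
  · linear_combination (-(q 1 * a 2 - q 2 * a 1)) * hnn - (n 1 * q 2 - n 2 * q 1) * ha
      + (n 1 * a 2 - n 2 * a 1) * hq
  · linear_combination (-(q 2 * a 0 - q 0 * a 2)) * hnn - (n 2 * q 0 - n 0 * q 2) * ha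
      + (n 2 * a 0 - n 0 * a 2) * hq
  · linear_combination (-(q 0 * a 1 - q 1 * a 0)) * hnn - (n 0 * q 1 - n 1 * q 0) * ha
      + (n 0 * a 1 - n 1 * a 0) * hq

lemma hasFDerivAt_apply_of_differentiableAt {E : Type*} [NormedAddCommGroup E] [NormedSpace ℝ E]
    {a : E → E3} {X : E} (ha : DifferentiableAt ℝ a X) (i : Fin 3) :
    HasFDerivAt (fun Y => a Y i) ((EuclideanSpace.proj i).comp (fderiv ℝ a X)) X :=
  (EuclideanSpace.proj (𝕜 := ℝ) i : E3 →L[ℝ] ℝ).hasFDerivAt.comp X ha.hasFDerivAt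

lemma fderiv_apply_of_differentiableAt {E : Type*} [NormedAddCommGroup E] [NormedSpace ℝ E]
    {a : E → E3} {X : E} (ha : DifferentiableAt ℝ a X) (i : Fin 3) (e : E) :
    fderiv ℝ (fun Y => a Y i) X e = fderiv ℝ a X e i := by
  rw [(hasFDerivAt_apply_of_differentiableAt ha i).fderiv]
  rfl

lemma fderiv_mul_dot3_cross3 {S : E2 → ℝ} {a b c : E2 → E3} {X : E2}
    (hS : DifferentiableAt ℝ S X) (ha : DifferentiableAt ℝ a X) (hb : DifferentiableAt ℝ b X)
    (hc : DifferentiableAt ℝ c X) (e : E2) :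
    fderiv ℝ (fun Y => S Y * dot3 (a Y) (cross3 (b Y) (c Y))) X e =
      fderiv ℝ S X e * dot3 (a X) (cross3 (b X) (c X))
      + S X * (dot3 (fderiv ℝ a X e) (cross3 (b X) (c X))
        + dot3 (a X) (cross3 (fderiv ℝ b X e) (c X))
        + dot3 (a X) (cross3 (b X) (fderiv ℝ c X e))) := by
  have A := hasFDerivAt_apply_of_differentiableAt ha
  have B := hasFDerivAt_apply_of_differentiableAt hb
  have C := hasFDerivAt_apply_of_differentiableAt hc
  have h := hS.hasFDerivAt.fun_mul
    ((((A 0).fun_mul (((B 1).fun_mul (C 2)).fun_sub ((B 2).fun_mul (C 1)))).fun_add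
      ((A 1).fun_mul (((B 2).fun_mul (C 0)).fun_sub ((B 0).fun_mul (C 2))))).fun_add
      ((A 2).fun_mul (((B 0).fun_mul (C 1)).fun_sub ((B 1).fun_mul (C 0)))))
  simp only [dot3, Fin.sum_univ_three]
  simp only [cross3, PiLp.continuousLinearEquiv_symm_apply, Matrix.cons_val_zero,
    Matrix.cons_val_one, Matrix.cons_val]
  rw [h.fderiv]
  simp
  ring

lemma fderiv_neg_mul_proj {S : E2 → ℝ} {n : E2 → E3} {X : E2} (hS : DifferentiableAt ℝ S X)
    (hn : DifferentiableAt ℝ n X) (c : ℝ) (i j : Fin 3) (e : E2) :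
    fderiv ℝ (fun Y => -S Y * (c - n Y i * n Y j)) X e =
      -(fderiv ℝ S X e * (c - n X i * n X j)
        - S X * (fderiv ℝ n X e i * n X j + n X i * fderiv ℝ n X e j)) := by
  have A := hasFDerivAt_apply_of_differentiableAt hn
  rw [(hS.hasFDerivAt.fun_neg.fun_mul (((A i).fun_mul (A j)).const_sub c)).fderiv]
  simp
  ring

lemma dot3_fderiv_eq_zero_of_unit {n : E2 → E3} {X : E2} (hn : DifferentiableAt ℝ n X)
    (h : ∀ᶠ Y in 𝓝 X, dot3 (n Y) (n Y) = 1) (e : E2) : dot3 (n X) (fderiv ℝ n X e) = 0 := by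
  have A := hasFDerivAt_apply_of_differentiableAt hn
  have h1 := (((A 0).fun_mul (A 0)).fun_add ((A 1).fun_mul (A 1))).fun_add
    ((A 2).fun_mul (A 2)) |>.fderiv
  have h2 : (fun Y => n Y 0 * n Y 0 + n Y 1 * n Y 1 + n Y 2 * n Y 2) =ᶠ[𝓝 X] fun _ => 1 := by
    filter_upwards [h] with Y hY
    simpa [dot3, Fin.sum_univ_three] using hY
  rw [h2.fderiv_eq] at h1
  have h3 := congrArg (fun l => l e) h1
  simp at h3
  simp only [dot3, Fin.sum_univ_three]
  linarith

/-- Equality of the mixed second partial derivatives. -/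
lemma fderiv_fderiv_apply_comm {f : E2 → E3} (hf : ContDiff ℝ 2 f) (X e e' : E2) :
    fderiv ℝ (fun Y => fderiv ℝ f Y e) X e' = fderiv ℝ (fun Y => fderiv ℝ f Y e') X e := by
  have hd : DifferentiableAt ℝ (fderiv ℝ f) X :=
    (hf.fderiv_right (m := 1) (by norm_num)).differentiable one_ne_zero X
  have hs : IsSymmSndFDerivAt ℝ f X := hf.contDiffAt.isSymmSndFDerivAt (by simp)
  have : ∀ u u' : E2, fderiv ℝ (fun Y => fderiv ℝ f Y u) X u' = fderiv ℝ (fderiv ℝ f) X u' u :=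
    fun u u' => by
      rw [(hd.hasFDerivAt.clm_apply (hasFDerivAt_const u X)).fderiv]
      simp
  rw [this, this]
  exact hs e' e

lemma dot3_self (a : E3) : dot3 a a = ‖a‖ ^ 2 := by
  simp [dot3, EuclideanSpace.norm_sq_eq, ← sq]

/-- The divergence identity behind the integration by parts formula on a surface. -/
lemma areaElt_mul_divergence {f : E2 → E3} (hf : ContDiff ℝ 2 f) {U : Set E2} (hU : IsOpen U)
    {N : E3 × ℝ → E3} (hN : ContDiff ℝ 1 N) {σ : E3 × ℝ → ℝ} (hσ : ContDiff ℝ 1 σ)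
    {φ : E3 → E3} (hφ : ContDiff ℝ 1 φ) {t : ℝ} (hJ : ∀ Y ∈ U, 0 < areaElt f Y)
    (hn : ∀ Y ∈ U, areaElt f Y • N (f Y, t) =
      cross3 (fderiv ℝ f Y (EuclideanSpace.single 0 1)) (fderiv ℝ f Y (EuclideanSpace.single 1 1)))
    {X : E2} (hX : X ∈ U) :
    areaElt f X * (sdiv N (fun p => φ p.1) (f X) t * σ (f X, t)
        - dot3 (sdivM N (fun p => (-σ p) • Pmat N p.1 p.2) (f X) t) (φ (f X))) =
      fderiv ℝ (fun Y => σ (f Y, t) * dot3 (φ (f Y))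
        (cross3 (fderiv ℝ f Y (EuclideanSpace.single 1 1)) (N (f Y, t)))) X
        (EuclideanSpace.single 0 1)
      + fderiv ℝ (fun Y => σ (f Y, t) * dot3 (φ (f Y))
        (cross3 (N (f Y, t)) (fderiv ℝ f Y (EuclideanSpace.single 0 1)))) X
        (EuclideanSpace.single 1 1) := by
  have hnn : ∀ Y ∈ U, dot3 (N (f Y, t)) (N (f Y, t)) = 1 := by
    intro Y hY
    have h := congrArg norm (hn Y hY)
    rw [norm_smul, Real.norm_eq_abs, abs_of_pos (hJ Y hY)] at h
    have h' : ‖N (f Y, t)‖ = 1 := mul_left_cancel₀ (hJ Y hY).ne' (by rw [h, mul_one]; rfl)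
    rw [dot3_self, h', one_pow]
  have hfd : DifferentiableAt ℝ f X := hf.differentiable two_ne_zero X
  have hf1 : ContDiff ℝ 1 f := hf.of_le (by norm_num)
  have hft : ContDiff ℝ 1 fun Y => (f Y, t) := hf1.prodMk contDiff_const
  have hSd : DifferentiableAt ℝ (fun Y => σ (f Y, t)) X :=
    (hσ.comp hft).differentiable one_ne_zero X
  have hnd : DifferentiableAt ℝ (fun Y => N (f Y, t)) X :=
    (hN.comp hft).differentiable one_ne_zero X
  have hφd : DifferentiableAt ℝ (fun Y => φ (f Y)) X :=
    (hφ.comp hf1).differentiable one_ne_zero X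
  have hgd : ∀ e, DifferentiableAt ℝ (fun Y => fderiv ℝ f Y e) X := fun e =>
    ((hf.fderiv_right (m := 1) (by norm_num)).clm_apply contDiff_const).differentiable
      one_ne_zero X
  have hnorth : ∀ e, dot3 (N (f X, t)) (fderiv ℝ (fun Y => N (f Y, t)) X e) = 0 :=
    dot3_fderiv_eq_zero_of_unit hnd (by filter_upwards [hU.mem_nhds hX] with Y hY using hnn Y hY)
  have hφj : ∀ j, ContDiff ℝ 1 fun p : E3 × ℝ => φ p.1 j := fun j =>
    contDiff_apply_of_contDiff (hφ.comp contDiff_fst) j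
  have hDφ : ∀ j e, ∑ i, fderiv ℝ f X e i * pdx i (fun p => φ p.1 j) (f X) t
      = fderiv ℝ (fun Y => φ (f Y)) X e j := fun j e => by
    rw [← fderiv_comp_slice (hφj j) hfd t e, ← fderiv_apply_of_differentiableAt hφd]
  have hDP : ∀ i j e, ∑ k, fderiv ℝ f X e k *
      pdx k (fun p => ((-σ p) • Pmat N p.1 p.2) i j) (f X) t =
      -(fderiv ℝ (fun Y => σ (f Y, t)) X e *
          ((if i = j then 1 else 0) - N (f X, t) i * N (f X, t) j)
        - σ (f X, t) * (fderiv ℝ (fun Y => N (f Y, t)) X e i * N (f X, t) j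
          + N (f X, t) i * fderiv ℝ (fun Y => N (f Y, t)) X e j)) := fun i j e => by
    rw [← fderiv_comp_slice (contDiff_neg_smul_Pmat_apply hN hσ i j) hfd t e]
    exact fderiv_neg_mul_proj hSd hnd (if i = j then 1 else 0) i j e
  have hdiv := fun j => areaElt_mul_tder rfl (hn X hX) (hnn X hX) (fun p => φ p.1 j) j
  have hdivM := fun i j => areaElt_mul_tder rfl (hn X hX) (hnn X hX)
    (fun p => ((-σ p) • Pmat N p.1 p.2) i j) j
  simp only [hDφ] at hdiv
  simp only [hDP] at hdivM
  have hnp : dot3 (N (f X, t)) (fderiv ℝ f X (EuclideanSpace.single 0 1)) = 0 := by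
    have h := congrArg (fun u => dot3 u (fderiv ℝ f X (EuclideanSpace.single 0 1))) (hn X hX)
    refine (mul_eq_zero.1 (?_ : areaElt f X * _ = 0)).resolve_left (hJ X hX).ne'
    simp only [dot3, cross3, Fin.sum_univ_three] at h ⊢
    simp at h
    linear_combination h
  have hnq : dot3 (N (f X, t)) (fderiv ℝ f X (EuclideanSpace.single 1 1)) = 0 := by
    have h := congrArg (fun u => dot3 u (fderiv ℝ f X (EuclideanSpace.single 1 1))) (hn X hX)
    refine (mul_eq_zero.1 (?_ : areaElt f X * _ = 0)).resolve_left (hJ X hX).ne'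
    simp only [dot3, cross3, Fin.sum_univ_three] at h ⊢
    simp at h
    linear_combination h
  have hq := cross3_apply_eq_of_orthogonal (hnn X hX) hnq (hnorth (EuclideanSpace.single 0 1))
  have hp := cross3_apply_eq_of_orthogonal (hnn X hX) (hnorth (EuclideanSpace.single 1 1)) hnp
  rw [fderiv_mul_dot3_cross3 hSd hφd (hgd _) hnd, fderiv_mul_dot3_cross3 hSd hφd hnd (hgd _),
    fderiv_fderiv_apply_comm hf X (EuclideanSpace.single 0 1) (EuclideanSpace.single 1 1)]
  have hL : areaElt f X * (sdiv N (fun p => φ p.1) (f X) t * σ (f X, t)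
        - dot3 (sdivM N (fun p => (-σ p) • Pmat N p.1 p.2) (f X) t) (φ (f X)))
      = σ (f X, t) * (∑ j, areaElt f X * tder N j (fun p => φ p.1 j) (f X) t)
        - ∑ i, φ (f X) i * ∑ j, areaElt f X *
          tder N j (fun p => ((-σ p) • Pmat N p.1 p.2) i j) (f X) t := by
    simp [sdiv, sdivM, dot3, Fin.sum_univ_three]
    ring
  rw [hL]
  simp only [hdiv, hdivM]
  generalize fderiv ℝ (fun Y => φ (f Y)) X (EuclideanSpace.single 0 1) = φ₀
  generalize fderiv ℝ (fun Y => φ (f Y)) X (EuclideanSpace.single 1 1) = φ₁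
  generalize fderiv ℝ (fun Y => σ (f Y, t)) X (EuclideanSpace.single 0 1) = S₀
  generalize fderiv ℝ (fun Y => σ (f Y, t)) X (EuclideanSpace.single 1 1) = S₁
  generalize fderiv ℝ (fun Y => N (f Y, t)) X (EuclideanSpace.single 0 1) = a at *
  generalize fderiv ℝ (fun Y => N (f Y, t)) X (EuclideanSpace.single 1 1) = b at *
  generalize fderiv ℝ (fun Y => fderiv ℝ f Y (EuclideanSpace.single 1 1)) X
    (EuclideanSpace.single 0 1) = c
  generalize fderiv ℝ f X (EuclideanSpace.single 0 1) = p at *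
  generalize fderiv ℝ f X (EuclideanSpace.single 1 1) = q at *
  generalize N (f X, t) = n at *
  generalize φ (f X) = w
  generalize σ (f X, t) = S
  clear hL hdiv hdivM hDφ hDP
  have q0 := hq 0
  have q1 := hq 1
  have q2 := hq 2
  have p0 := hp 0
  have p1 := hp 1
  have p2 := hp 2
  simp [cross3, dot3, Fin.sum_univ_three] at q0 q1 q2 p0 p1 p2 ⊢
  linear_combination (-S * w 0) * (q0 + p0) + (-S * w 1) * (q1 + p1) + (-S * w 2) * (q2 + p2)

lemma contDiff_mul_dot3_cross3 {S : E2 → ℝ} {a b c : E2 → E3} (hS : ContDiff ℝ 1 S)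
    (ha : ContDiff ℝ 1 a) (hb : ContDiff ℝ 1 b) (hc : ContDiff ℝ 1 c) :
    ContDiff ℝ 1 fun Y => S Y * dot3 (a Y) (cross3 (b Y) (c Y)) := by
  have A := contDiff_apply_of_contDiff ha
  have B := contDiff_apply_of_contDiff hb
  have C := contDiff_apply_of_contDiff hc
  simp only [dot3, Fin.sum_univ_three]
  simp only [cross3, PiLp.continuousLinearEquiv_symm_apply, Matrix.cons_val_zero,
    Matrix.cons_val_one, Matrix.cons_val]
  exact hS.mul ((((A 0).mul (((B 1).mul (C 2)).sub ((B 2).mul (C 1)))).add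
    ((A 1).mul (((B 2).mul (C 0)).sub ((B 0).mul (C 2))))).add
    ((A 2).mul (((B 0).mul (C 1)).sub ((B 1).mul (C 0)))))

/-- **Integration by parts** on a parametrized surface, for a field vanishing off a compact
piece. -/
theorem setIntegral_sdiv_mul_sub_eq_zero {f : E2 → E3} (hf : ContDiff ℝ 2 f) {U K : Set E2}
    (hU : IsOpen U) (hUb : Bornology.IsBounded U) (hinj : Set.InjOn f U) (hK : IsCompact K)
    (hKU : K ⊆ U) {N : E3 × ℝ → E3} (hN : ContDiff ℝ 1 N) {σ : E3 × ℝ → ℝ}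
    (hσ : ContDiff ℝ 1 σ) {φ : E3 → E3} (hφ : ContDiff ℝ 1 φ) {t : ℝ}
    (hφK : ∀ X ∈ U \ K, φ (f X) = 0) (hJ : ∀ Y ∈ U, 0 < areaElt f Y)
    (hn : ∀ Y ∈ U, areaElt f Y • N (f Y, t) =
      cross3 (fderiv ℝ f Y (EuclideanSpace.single 0 1))
        (fderiv ℝ f Y (EuclideanSpace.single 1 1))) :
    ∫ x in f '' U, (sdiv N (fun p => φ p.1) x t * σ (x, t)
      - dot3 (sdivM N (fun p => (-σ p) • Pmat N p.1 p.2) x t) (φ x)) ∂(μH[2] : Measure E3) = 0 := by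
  have hf1 : ContDiff ℝ 1 f := hf.of_le (by norm_num)
  have hft : ContDiff ℝ 1 fun Y => (f Y, t) := hf1.prodMk contDiff_const
  have hg : ∀ e, ContDiff ℝ 1 fun Y => fderiv ℝ f Y e := fun e =>
    (hf.fderiv_right (m := 1) (by norm_num)).clm_apply contDiff_const
  obtain ⟨i₀, h₀⟩ := setIntegral_fderiv_apply_eq_zero
    (contDiff_mul_dot3_cross3 (hσ.comp hft) (hφ.comp hf1) (hg (EuclideanSpace.single 1 1))
      (hN.comp hft)) hU hK hKU (fun X hX => by simp [hφK X hX, dot3])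
    (EuclideanSpace.single 0 1)
  obtain ⟨i₁, h₁⟩ := setIntegral_fderiv_apply_eq_zero
    (contDiff_mul_dot3_cross3 (hσ.comp hft) (hφ.comp hf1) (hN.comp hft)
      (hg (EuclideanSpace.single 0 1))) hU hK hKU (fun X hX => by simp [hφK X hX, dot3])
    (EuclideanSpace.single 1 1)
  rw [setIntegral_image_hausdorffMeasure hf1 hU hUb hinj hJ]
  exact (setIntegral_congr_fun hU.measurableSet fun X hX =>
    areaElt_mul_divergence hf hU hN hσ hφ hJ hn hX).trans
      ((integral_add i₀ i₁).trans (by rw [h₀, h₁, add_zero]))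

end SurfaceDivergence

/-- variation of the work `E_W` with respect to the velocity. -/
theorem variation_of_work
    (T : ℝ) (hT : 0 < T)
    (U : Set E2) (hUopen : IsOpen U) (hUne : U.Nonempty) (hUbd : Bornology.IsBounded U)
    (xh : E2 × ℝ → E3) (hxh : ContDiff ℝ 2 xh)
    (lam : ℝ) (hlam : 0 < lam)
    (hG : ∀ X ∈ U, ∀ t ∈ Set.Ico (0 : ℝ) T, lam ≤ Gdet xh X t)
    (hinj : ∀ t ∈ Set.Ico (0 : ℝ) T, Set.InjOn (fun X => xh (X, t)) U)
    (Γ : ℝ → Set E3) (hΓ : ∀ t, Γ t = (fun X => xh (X, t)) '' U)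
    (N : E3 × ℝ → E3) (hN : ContDiff ℝ 1 N)
    (hNs : ∀ X ∈ U, ∀ t ∈ Set.Ico (0 : ℝ) T, N (xh (X, t), t) = nHat xh X t)
    (v : E3 × ℝ → E3) (hv : ContDiff ℝ 2 v)
    (hflow : ∀ X ∈ U, ∀ t ∈ Set.Ico (0 : ℝ) T,
      deriv (fun s => xh (X, s)) t = v (xh (X, t), t))
    (ρ σ : E3 × ℝ → ℝ) (hρ : ContDiff ℝ 1 ρ) (hσ : ContDiff ℝ 1 σ)
    (F : E3 × ℝ → E3) (hF : ContDiff ℝ 1 F)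
    (t : ℝ) (ht : t ∈ Set.Ioo (0 : ℝ) T)
    (φ : E3 → E3) (hφ : ContDiff ℝ 1 φ)
    (K : Set E2) (hK : IsCompact K) (hKU : K ⊆ U)
    (hφsupp : ∀ X ∈ U \ K, φ (xh (X, t)) = 0) :
    HasDerivAt
      (fun ε : ℝ =>
        ∫ x in Γ t,
          (sdiv N (fun p => v p + ε • φ p.1) x t * σ (x, t)
            + ρ (x, t) * dot3 (F (x, t)) (v (x, t) + ε • φ x)) ∂(μH[2] : Measure E3))
      (∫ x in Γ t,
        dot3 (sdivM N (fun p => (-σ p) • Pmat N p.1 p.2) x t + ρ (x, t) • F (x, t))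
          (φ x) ∂(μH[2] : Measure E3)) 0 := by

  have htI : t ∈ Set.Ico (0 : ℝ) T := ⟨ht.1.le, ht.2⟩
  let f : E2 → E3 := fun X => xh (X, t)
  have hf : ContDiff ℝ 2 f := contDiff_slice hxh t
  have hf1 : ContDiff ℝ 1 f := hf.of_le (by norm_num)
  have hJ : ∀ X ∈ U, 0 < areaElt f X := by
    intro X hX
    have h : areaElt f X ^ 2 = Gdet xh X t := by
      have := norm_cross3_sq (gVec xh 0 X t) (gVec xh 1 X t)
      rw [← dot3_self (gVec xh 0 X t), ← dot3_self (gVec xh 1 X t)] at this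
      refine this.trans ?_
      simp only [Gdet, gMet, dot3, Fin.sum_univ_three]
      ring
    have hpos : 0 < areaElt f X ^ 2 := by rw [h]; exact hlam.trans_le (hG X hX t htI)
    exact lt_of_le_of_ne (norm_nonneg _) fun h0 => by simp [← h0] at hpos
  have hn : ∀ Y ∈ U, areaElt f Y • N (f Y, t) = cross3
      (fderiv ℝ f Y (EuclideanSpace.single 0 1)) (fderiv ℝ f Y (EuclideanSpace.single 1 1)) := by
    intro Y hY
    rw [hNs Y hY t htI]
    exact smul_inv_smul₀ (hJ Y hY).ne' _
  have hcomp : ∀ {g : E3 × ℝ → E3}, Continuous g → ∀ i, Continuous fun x => g (x, t) i :=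
    fun hg i => (EuclideanSpace.proj i).continuous.comp (hg.comp (by fun_prop))
  have hσc : Continuous fun x => σ (x, t) := hσ.continuous.comp (by fun_prop)
  have hρc : Continuous fun x => ρ (x, t) := hρ.continuous.comp (by fun_prop)
  have hFc := hcomp hF.continuous
  have hvc := hcomp hv.continuous
  have hφ' : ContDiff ℝ 1 fun p : E3 × ℝ => φ p.1 := hφ.comp contDiff_fst
  have hφc := hcomp hφ'.continuous
  have hv1 : ContDiff ℝ 1 v := hv.of_le (by norm_num)
  have hint : ∀ {g : E3 → ℝ}, Continuous g → IntegrableOn g (Γ t) (μH[2] : Measure E3) := by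
    intro g hg
    have hsub : Γ t ⊆ f '' closure U := by rw [hΓ]; exact Set.image_mono subset_closure
    have hlt := hausdorffMeasure_image_closure_lt_top hf1 hUbd
    obtain ⟨C, hC⟩ := (hUbd.isCompact_closure.image hf1.continuous).exists_bound_of_continuousOn
      hg.continuousOn
    refine (Measure.integrableOn_of_bounded hlt.ne hg.aestronglyMeasurable (M := C) ?_).mono_set
      hsub
    exact (ae_restrict_mem
      (hUbd.isCompact_closure.image hf1.continuous).isClosed.measurableSet).mono hC
  let A : E3 → ℝ := fun x => sdiv N v x t * σ (x, t) + ρ (x, t) * dot3 (F (x, t)) (v (x, t))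
  let B : E3 → ℝ := fun x =>
    sdiv N (fun p => φ p.1) x t * σ (x, t) + ρ (x, t) * dot3 (F (x, t)) (φ x)
  let C : E3 → ℝ := fun x =>
    dot3 (sdivM N (fun p => (-σ p) • Pmat N p.1 p.2) x t + ρ (x, t) • F (x, t)) (φ x)
  have hA : Continuous A := by
    have := continuous_sdiv hN.continuous hv1 t
    simp only [A, dot3]
    fun_prop
  have hB : Continuous B := by
    have := continuous_sdiv hN.continuous hφ' t
    simp only [B, dot3]
    fun_prop
  have hC : Continuous C :=
    continuous_finsetSum _ fun i _ =>
      ((continuous_sdivM_apply hN hσ i t).add (hρc.mul (hFc i))).mul (hφc i)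
  have hE : ∀ ε : ℝ, ∫ x in Γ t, (sdiv N (fun p => v p + ε • φ p.1) x t * σ (x, t)
      + ρ (x, t) * dot3 (F (x, t)) (v (x, t) + ε • φ x)) ∂(μH[2] : Measure E3)
      = ∫ x in Γ t, A x ∂(μH[2] : Measure E3) + ε * ∫ x in Γ t, B x ∂(μH[2] : Measure E3) := by
    intro ε
    rw [← integral_const_mul, ← integral_add (hint hA) ((hint hB).const_mul ε)]
    congr 1
    funext x
    simp only [A, B, sdiv_add_const_smul hv1 hφ', dot3, Fin.sum_univ_three, PiLp.add_apply,
      PiLp.smul_apply, smul_eq_mul]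
    ring
  have hBC : ∫ x in Γ t, B x ∂(μH[2] : Measure E3) = ∫ x in Γ t, C x ∂(μH[2] : Measure E3) := by
    rw [← sub_eq_zero, ← integral_sub (hint hB) (hint hC), hΓ]
    rw [← setIntegral_sdiv_mul_sub_eq_zero hf hUopen hUbd (hinj t htI) hK hKU hN hσ hφ hφsupp hJ hn]
    congr 1
    funext x
    simp only [B, C, dot3, Fin.sum_univ_three, PiLp.add_apply, PiLp.smul_apply, smul_eq_mul]
    ring
  simp only [hE]
  have h := ((hasDerivAt_id (0 : ℝ)).mul_const
    (∫ x in Γ t, B x ∂(μH[2] : Measure E3))).const_add (∫ x in Γ t, A x ∂(μH[2] : Measure E3))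
  rw [one_mul, hBC] at h
  rw [hBC]
  exact h
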